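/- (Robust performance via D-scales.) Let A ∈ ℝ^{n×n} be Schur stable, B = [B_w, B_d] ∈ ℝ^{n×(n_w+n_d)}, C = [C_v; C_e] ∈ ℝ^{(n_v+n_e)×n}, and D ∈ ℝ^{(n_v+n_e)×(n_w+n_d)} partitioned conformably with blocks D_vw, D_vd, D_ew, D_ed; define the frequency response M(e^{iθ}) := C(e^{iθ}I − A)⁻¹B + D with blocks M₁₁(e^{iθ}) ∈ ℂ^{n_v×n_w} etc. The following are equivalent: (A) there exists a function D : [0,2π] → (0,∞) such that σ̄(diag(D(θ)·I_{n_v}, I_{n_e}) · M(e^{iθ}) · diag(D(θ)⁻¹·I_{n_w}, I_{n_d})) < 1 for all θ ∈ [0,2π]; (B) for every m ∈ ℕ and all matrices A_Δ ∈ ℝ^{m×m}, B_Δ ∈ ℝ^{m×n_v}, C_Δ ∈ ℝ^{n_w×m}, D_Δ ∈ ℝ^{n_w×n_v} with A_Δ Schur stable and σ̄(Δ(e^{iθ})) ≤ 1 for all θ ∈ [0,2π], where Δ(z) := C_Δ(zI − A_Δ)⁻¹B_Δ + D_Δ, it holds that: I_{n_v} − D_vwD_Δ is invertible, the interconnected state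 matrix Ã := [[A,0],[0,A_Δ]] + [[0,B_w],[B_Δ,0]] · [[I_{n_v}, −D_vw],[−D_Δ, I_{n_w}]]⁻¹ · [[C_v, 0],[0, C_Δ]] is Schur stable, and σ̄(M₂₂(e^{iθ}) + M₂₁(e^{iθ})Δ(e^{iθ})(I − M₁₁(e^{iθ})Δ(e^{iθ}))⁻¹M₁₂(e^{iθ})) < 1 for all θ ∈ [0,2π]. -/

import Mathlib

open Matrix

noncomputable section

/-- A real square matrix is Schur stable if every complex eigenvalue has modulus `< 1`. -/
def SchurStable {k : Type*} [Fintype k] [DecidableEq k] (A : Matrix k k ℝ) : Prop :=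
  ∀ μ ∈ spectrum ℂ (A.map (algebraMap ℝ ℂ)), ‖μ‖ < 1

/-- Largest singular value (operator 2-norm) of a complex matrix. -/
def sigmaMax {k l : Type*} [Fintype k] [Fintype l] [DecidableEq k] [DecidableEq l]
    (M : Matrix k l ℂ) : ℝ :=
  ‖LinearMap.toContinuousLinearMap (Matrix.toEuclideanLin M)‖

/-- Transfer function of a real state-space realization, evaluated at `z ∈ ℂ`. -/
def transferFn {n k l : ℕ} (A : Matrix (Fin n) (Fin n) ℝ) (B : Matrix (Fin n) (Fin l) ℝ)
    (C : Matrix (Fin k) (Fin n) ℝ) (D : Matrix (Fin k) (Fin l) ℝ) (z : ℂ) :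
    Matrix (Fin k) (Fin l) ℂ :=
  C.map (algebraMap ℝ ℂ) *
    (z • (1 : Matrix (Fin n) (Fin n) ℂ) - A.map (algebraMap ℝ ℂ))⁻¹ *
    B.map (algebraMap ℝ ℂ) + D.map (algebraMap ℝ ℂ)

/-- State matrix of the feedback interconnection of `M₁₁` with `Δ`. -/
def interconnectA {n m nv nw : ℕ}
    (A : Matrix (Fin n) (Fin n) ℝ) (Bw : Matrix (Fin n) (Fin nw) ℝ)
    (Cv : Matrix (Fin nv) (Fin n) ℝ) (Dvw : Matrix (Fin nv) (Fin nw) ℝ)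
    (AΔ : Matrix (Fin m) (Fin m) ℝ) (BΔ : Matrix (Fin m) (Fin nv) ℝ)
    (CΔ : Matrix (Fin nw) (Fin m) ℝ) (DΔ : Matrix (Fin nw) (Fin nv) ℝ) :
    Matrix ((Fin n) ⊕ (Fin m)) ((Fin n) ⊕ (Fin m)) ℝ :=
  Matrix.fromBlocks A 0 0 AΔ +
    Matrix.fromBlocks 0 Bw BΔ 0 *
      (Matrix.fromBlocks (1 : Matrix (Fin nv) (Fin nv) ℝ) (-Dvw) (-DΔ)
        (1 : Matrix (Fin nw) (Fin nw) ℝ))⁻¹ *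
      Matrix.fromBlocks Cv 0 0 CΔ


def nsq {k : Type*} [Fintype k] (x : k → ℂ) : ℝ := ∑ i, ‖x i‖ ^ 2

lemma nsq_nonneg {k : Type*} [Fintype k] (x : k → ℂ) : 0 ≤ nsq x :=
  Finset.sum_nonneg fun _ _ => sq_nonneg _

lemma nsq_zero {k : Type*} [Fintype k] : nsq (0 : k → ℂ) = 0 := by simp [nsq]

lemma nsq_eq_zero {k : Type*} [Fintype k] {x : k → ℂ} (h : nsq x = 0) : x = 0 := by
  unfold nsq at h
  rw [Finset.sum_eq_zero_iff_of_nonneg (fun _ _ => sq_nonneg _)] at h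
  ext i
  simpa using h i (Finset.mem_univ i)

lemma nsq_pos {k : Type*} [Fintype k] {x : k → ℂ} (h : x ≠ 0) : 0 < nsq x :=
  lt_of_le_of_ne (nsq_nonneg x) fun h' => h (nsq_eq_zero h'.symm)

lemma nsq_eq_norm {k : Type*} [Fintype k] (x : k → ℂ) :
    nsq x = ‖(WithLp.toLp 2 x : EuclideanSpace ℂ k)‖ ^ 2 := by
  rw [EuclideanSpace.norm_sq_eq]; rfl

lemma nsq_elim {k l : Type*} [Fintype k] [Fintype l] (x : k → ℂ) (y : l → ℂ) :
    nsq (Sum.elim x y) = nsq x + nsq y := by simp [nsq]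

lemma nsq_smul {k : Type*} [Fintype k] (c : ℂ) (x : k → ℂ) :
    nsq (c • x) = ‖c‖ ^ 2 * nsq x := by
  simp [nsq, mul_pow, Finset.mul_sum]

lemma sigmaMax_le_one_iff {k l : Type*} [Fintype k] [Fintype l] [DecidableEq k] [DecidableEq l]
    (M : Matrix k l ℂ) : sigmaMax M ≤ 1 ↔ ∀ x, nsq (M *ᵥ x) ≤ nsq x := by
  unfold sigmaMax
  rw [ContinuousLinearMap.opNorm_le_iff zero_le_one]
  constructor
  · intro h x
    have := h (WithLp.toLp 2 x)
    rw [nsq_eq_norm, nsq_eq_norm]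
    rw [one_mul] at this
    exact pow_le_pow_left₀ (norm_nonneg _) this 2
  · intro h x
    have := h (WithLp.ofLp x)
    rw [nsq_eq_norm, nsq_eq_norm] at this
    rw [one_mul]
    exact le_of_sq_le_sq this (norm_nonneg _)

lemma sigmaMax_lt_one_of {k l : Type*} [Fintype k] [Fintype l] [DecidableEq k] [DecidableEq l]
    (M : Matrix k l ℂ) (h : ∀ x ≠ 0, nsq (M *ᵥ x) < nsq x) : sigmaMax M < 1 := by
  unfold sigmaMax
  set T := LinearMap.toContinuousLinearMap (Matrix.toEuclideanLin M) with hT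
  have hT' : ∀ x, x ≠ 0 → ‖T x‖ < ‖x‖ := by
    intro x hx
    have := h (WithLp.ofLp x) (by simpa using hx)
    rw [nsq_eq_norm, nsq_eq_norm] at this
    exact lt_of_pow_lt_pow_left₀ 2 (norm_nonneg _) this
  rcases (Metric.sphere (0 : EuclideanSpace ℂ l) 1).eq_empty_or_nonempty with he | hne
  · have : T = 0 := by
      ext1 x
      by_cases hx : x = 0
      · simp [hx]
      · exfalso
        have : ((‖x‖ : ℂ)⁻¹) • x ∈ Metric.sphere (0 : EuclideanSpace ℂ l) 1 := by
          simp [norm_smul, hx]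
        rw [he] at this
        exact this
    rw [this]; simp
  · obtain ⟨x, hx, hmax⟩ := (isCompact_sphere (0 : EuclideanSpace ℂ l) 1).exists_isMaxOn hne
      (f := fun x => ‖T x‖) (by fun_prop)
    have hx1 : ‖x‖ = 1 := by simpa using hx
    have hlt : ‖T x‖ < 1 := by
      rw [← hx1]; apply hT'; rintro rfl; simp at hx1
    refine lt_of_le_of_lt ?_ hlt
    refine ContinuousLinearMap.opNorm_le_of_unit_norm (norm_nonneg _) ?_
    intro y hy
    exact hmax (by simpa using hy)

lemma sigmaMax_lt_one {k l : Type*} [Fintype k] [Fintype l] [DecidableEq k] [DecidableEq l]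
    {M : Matrix k l ℂ} (h : sigmaMax M < 1) {x : l → ℂ} (hx : x ≠ 0) :
    nsq (M *ᵥ x) < nsq x := by
  unfold sigmaMax at h
  have h1 := (LinearMap.toContinuousLinearMap (Matrix.toEuclideanLin M)).le_opNorm (WithLp.toLp 2 x)
  have hpos : 0 < ‖(WithLp.toLp 2 x : EuclideanSpace ℂ l)‖ := by simpa using hx
  rw [nsq_eq_norm, nsq_eq_norm]
  refine pow_lt_pow_left₀ (lt_of_le_of_lt h1 ?_) (norm_nonneg _) two_ne_zero
  nlinarith

/-- S-lemma -/
lemma s_lemma {V : Type*} [NormedAddCommGroup V] [NormedSpace ℝ V] [FiniteDimensional ℝ V]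
    (q1 q2 : V → ℝ) (c1 : Continuous q1) (c2 : Continuous q2)
    (h1 : ∀ x y, ∃ b, ∀ s t : ℝ, q1 (s • x + t • y) = s ^ 2 * q1 x + s * t * b + t ^ 2 * q1 y)
    (h2 : ∀ x y, ∃ b, ∀ s t : ℝ, q2 (s • x + t • y) = s ^ 2 * q2 x + s * t * b + t ^ 2 * q2 y)
    (hno : ∀ x ≠ 0, 0 ≤ q1 x → q2 x < 0) :
    ∃ d : ℝ, 0 < d ∧ ∀ x ≠ 0, d * q1 x + q2 x < 0 := by
  have hs1 : ∀ (s : ℝ) x, q1 (s • x) = s ^ 2 * q1 x := by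
    intro s x; obtain ⟨b, hb⟩ := h1 x x; simpa using hb s 0
  have hs2 : ∀ (s : ℝ) x, q2 (s • x) = s ^ 2 * q2 x := by
    intro s x; obtain ⟨b, hb⟩ := h2 x x; simpa using hb s 0
  -- key
  have key : ∀ c : ℝ, 0 ≤ c → ∀ x ≠ 0, ∀ y ≠ 0, 0 ≤ q1 x → q1 y < 0 → 0 ≤ c * q1 x + q2 x →
      0 ≤ c * q1 y + q2 y → False := by
    have key' : ∀ c : ℝ, 0 ≤ c → ∀ x ≠ 0, ∀ y ≠ 0, 0 ≤ q1 x → q1 y < 0 → 0 ≤ c * q1 x + q2 x →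
        0 ≤ c * q1 y + q2 y → (∀ s t : ℝ, 0 ≤ s → 0 ≤ t → 0 ≤ c * q1 (s • x + t • y) + q2 (s • x + t • y)) → False := by
      intro c hc x hx y hy hqx hqy hLx hLy hL
      have hcont : ContinuousOn (fun t : ℝ => q1 ((1 - t) • x + t • y)) (Set.Icc 0 1) := by
        apply Continuous.continuousOn
        fun_prop
      have hmem : (0 : ℝ) ∈ Set.Icc ((fun t : ℝ => q1 ((1 - t) • x + t • y)) 1)
          ((fun t : ℝ => q1 ((1 - t) • x + t • y)) 0) := by
        simp [hqx, hqy.le]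
      obtain ⟨t, ⟨ht0, ht1⟩, ht⟩ := intermediate_value_Icc' zero_le_one hcont hmem
      simp only at ht
      have hz := hL (1 - t) t (by linarith) ht0
      by_cases hz0 : (1 - t) • x + t • y = 0
      · rcases eq_or_ne t 0 with rfl | htne
        · simp at hz0; exact hx hz0
        · have e : t • y = (-(1 - t)) • x := by
            rw [neg_smul]; exact eq_neg_of_add_eq_zero_right hz0
          have := congrArg q1 e
          rw [hs1, hs1] at this
          have : 0 < t ^ 2 := by positivity
          nlinarith [sq_nonneg (1 - t), mul_nonneg (sq_nonneg (1-t)) hqx]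
      · have := hno _ hz0 ht.ge
        rw [ht] at hz
        linarith
    intro c hc x hx y hy hqx hqy hLx hLy
    obtain ⟨b1, hb1⟩ := h1 x y
    obtain ⟨b2, hb2⟩ := h2 x y
    by_cases hb : 0 ≤ c * b1 + b2
    · refine key' c hc x hx y hy hqx hqy hLx hLy ?_
      intro s t hs ht
      rw [hb1, hb2]
      have e1 := mul_nonneg (mul_nonneg hs ht) hb
      have e2 := mul_nonneg (sq_nonneg s) hLx
      have e3 := mul_nonneg (sq_nonneg t) hLy
      nlinarith
    · have f1 : q1 (-y) = q1 y := by simpa using hs1 (-1) y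
      have f2 : q2 (-y) = q2 y := by simpa using hs2 (-1) y
      refine key' c hc x hx (-y) (by simpa using hy) hqx (by rwa [f1]) hLx (by rwa [f1, f2]) ?_
      intro s t hs ht
      have : s • x + t • (-y) = s • x + (-t) • y := by simp
      rw [this, hb1, hb2]
      have e1 := mul_nonneg (mul_nonneg hs ht) (neg_nonneg.2 (not_le.1 hb).le)
      have e2 := mul_nonneg (sq_nonneg s) hLx
      have e3 := mul_nonneg (sq_nonneg t) hLy
      nlinarith
  -- reduce to sphere
  suffices H : ∃ d : ℝ, 0 < d ∧ ∀ x ∈ Metric.sphere (0 : V) 1, d * q1 x + q2 x < 0 by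
    obtain ⟨d, hd, H⟩ := H
    refine ⟨d, hd, fun x hx => ?_⟩
    have hp : 0 < ‖x‖ := norm_pos_iff.2 hx
    have := H (‖x‖⁻¹ • x) (by simp [norm_smul, hx])
    rw [hs1, hs2] at this
    have h3 : 0 < (‖x‖⁻¹) ^ 2 := by positivity
    by_contra hcon
    nlinarith [mul_nonneg h3.le (not_lt.1 hcon)]
  have hsne : ∀ x ∈ Metric.sphere (0 : V) 1, x ≠ 0 := by
    rintro x hx rfl; simp at hx
  have : ProperSpace V := FiniteDimensional.proper ℝ V
  have hS := isCompact_sphere (0 : V) 1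
  have K1 : IsCompact (Metric.sphere (0 : V) 1 ∩ {x | 0 ≤ q1 x}) :=
    hS.inter_right (isClosed_le continuous_const c1)
  have K2 : IsCompact (Metric.sphere (0 : V) 1 ∩ {x | 0 ≤ q2 x}) :=
    hS.inter_right (isClosed_le continuous_const c2)
  have hno2 : ∀ x ≠ 0, 0 ≤ q2 x → q1 x < 0 := by
    intro x hx h; by_contra hc; exact absurd (hno x hx (not_lt.1 hc)) (not_lt.2 h)
  -- c
  have hc : ∃ c : ℝ, 0 ≤ c ∧ (∀ y ∈ Metric.sphere (0 : V) 1, 0 ≤ q2 y → q2 y ≤ c * (-q1 y)) ∧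
      (c = 0 ∨ ∃ y ∈ Metric.sphere (0 : V) 1, 0 ≤ q2 y ∧ q2 y = c * (-q1 y)) := by
    rcases (Metric.sphere (0 : V) 1 ∩ {x | 0 ≤ q2 x}).eq_empty_or_nonempty with he | hne
    · refine ⟨0, le_rfl, fun y hy hq => ?_, Or.inl rfl⟩
      have : y ∈ (Metric.sphere (0 : V) 1 ∩ {x | 0 ≤ q2 x}) := ⟨hy, hq⟩
      rw [he] at this; exact this.elim
    · obtain ⟨y, ⟨hy, hyq⟩, hmax⟩ := K2.exists_isMaxOn hne (f := fun y => q2 y / (-q1 y))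
        (c2.continuousOn.div c1.neg.continuousOn
          (fun y hy => by have := hno2 y (hsne y hy.1) hy.2; linarith))
      have hq1 : q1 y < 0 := hno2 y (hsne y hy) hyq
      refine ⟨q2 y / (-q1 y), div_nonneg hyq (by linarith), fun x hx hq => ?_,
        Or.inr ⟨y, hy, hyq, ?_⟩⟩
      · have hq1x : q1 x < 0 := hno2 x (hsne x hx) hq
        have := hmax (show x ∈ _ from ⟨hx, hq⟩)
        exact (div_le_iff₀ (by linarith)).1 this
      · have : -q1 y ≠ 0 := by linarith
        exact (div_mul_cancel₀ _ this).symm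
  have hr : ∃ c : ℝ, 0 ≤ c ∧ (∀ y ∈ Metric.sphere (0 : V) 1, 0 ≤ q1 y → q1 y ≤ c * (-q2 y)) ∧
      (c = 0 ∨ ∃ y ∈ Metric.sphere (0 : V) 1, 0 ≤ q1 y ∧ q1 y = c * (-q2 y)) := by
    rcases (Metric.sphere (0 : V) 1 ∩ {x | 0 ≤ q1 x}).eq_empty_or_nonempty with he | hne
    · refine ⟨0, le_rfl, fun y hy hq => ?_, Or.inl rfl⟩
      have : y ∈ (Metric.sphere (0 : V) 1 ∩ {x | 0 ≤ q1 x}) := ⟨hy, hq⟩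
      rw [he] at this; exact this.elim
    · obtain ⟨y, ⟨hy, hyq⟩, hmax⟩ := K1.exists_isMaxOn hne (f := fun y => q1 y / (-q2 y))
        (c1.continuousOn.div c2.neg.continuousOn
          (fun y hy => by have := hno y (hsne y hy.1) hy.2; linarith))
      have hq1 : q2 y < 0 := hno y (hsne y hy) hyq
      refine ⟨q1 y / (-q2 y), div_nonneg hyq (by linarith), fun x hx hq => ?_,
        Or.inr ⟨y, hy, hyq, ?_⟩⟩
      · have hq1x : q2 x < 0 := hno x (hsne x hx) hq
        have := hmax (show x ∈ _ from ⟨hx, hq⟩)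
        exact (div_le_iff₀ (by linarith)).1 this
      · have : -q2 y ≠ 0 := by linarith
        exact (div_mul_cancel₀ _ this).symm
  obtain ⟨c, hc0, hcle, hcex⟩ := hc
  obtain ⟨r, hr0, hrle, hrex⟩ := hr
  have hcr : c * r < 1 := by
    rcases hcex with rfl | ⟨y, hy, hyq, hye⟩
    · simp
    rcases hrex with rfl | ⟨x, hx, hxq, hxe⟩
    · simp
    by_contra hcon
    have hq2x := hno x (hsne x hx) hxq
    refine key c hc0 x (hsne x hx) y (hsne y hy) hxq (hno2 y (hsne y hy) hyq) ?_ (by linarith)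
    rw [hxe]
    nlinarith [mul_nonneg (sub_nonneg.2 (not_lt.1 hcon)) (neg_nonneg.2 hq2x.le)]
  obtain ⟨d, hcd, hdr⟩ : ∃ d, c < d ∧ d * r < 1 := by
    refine ⟨c + (1 - c * r) / (r + 1), ?_, ?_⟩
    · have : 0 < (1 - c * r) / (r + 1) := div_pos (by linarith) (by linarith)
      linarith
    · have h3 : 0 < r + 1 := by linarith
      have : (c + (1 - c * r) / (r + 1)) * r = c * r + (1 - c * r) * (r / (r + 1)) := by ring
      rw [this]
      have : r / (r + 1) < 1 := by rw [div_lt_one h3]; linarith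
      nlinarith
  refine ⟨d, by linarith, fun x hx => ?_⟩
  by_cases hq1 : 0 ≤ q1 x
  · have hq2 := hno x (hsne x hx) hq1
    have h3 := hrle x hx hq1
    have : d * q1 x ≤ d * (r * (-q2 x)) := mul_le_mul_of_nonneg_left h3 (by linarith)
    nlinarith
  · by_cases hq2 : 0 ≤ q2 x
    · have h3 := hcle x hx hq2
      nlinarith
    · have : d * q1 x < 0 := mul_neg_of_pos_of_neg (by linarith) (by linarith)
      linarith

lemma schur_isUnit {k : Type*} [Fintype k] [DecidableEq k] {A : Matrix k k ℝ}
    (hA : SchurStable A) {z : ℂ} (hz : 1 ≤ ‖z‖) :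
    IsUnit (z • (1 : Matrix k k ℂ) - A.map (algebraMap ℝ ℂ)) := by
  by_contra h
  have : z ∈ spectrum ℂ (A.map (algebraMap ℝ ℂ)) := by
    rw [spectrum.mem_iff, Algebra.algebraMap_eq_smul_one]; exact h
  exact absurd (hA z this) (not_lt.2 hz)

lemma schur_isUnit' {k : Type*} [Fintype k] [DecidableEq k] {A : Matrix k k ℝ}
    (hA : SchurStable A) {w : ℂ} (hw : ‖w‖ ≤ 1) :
    IsUnit ((1 : Matrix k k ℂ) - w • A.map (algebraMap ℝ ℂ)) := by
  rcases eq_or_ne w 0 with rfl | h0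
  · simp
  · have h1 : 1 ≤ ‖w⁻¹‖ := by
      rw [norm_inv]; exact (one_le_inv₀ (norm_pos_iff.2 h0)).2 hw
    have := (schur_isUnit hA h1).smul (Units.mk0 w h0)
    convert this using 1
    rw [Units.smul_def, Units.val_mk0, smul_sub, smul_smul, mul_inv_cancel₀ h0, one_smul]

open scoped Matrix.Norms.L2Operator in
lemma max_mod {n k l : ℕ} (A : Matrix (Fin n) (Fin n) ℝ) (B : Matrix (Fin n) (Fin l) ℝ)
    (C : Matrix (Fin k) (Fin n) ℝ) (D : Matrix (Fin k) (Fin l) ℝ) (hA : SchurStable A) :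
    ∃ θ ∈ Set.Icc (0 : ℝ) (2 * Real.pi),
      (∀ z : ℂ, 1 ≤ ‖z‖ → sigmaMax (transferFn A B C D z) ≤
        sigmaMax (transferFn A B C D (Complex.exp ((θ : ℂ) * Complex.I)))) ∧
      sigmaMax (D.map (algebraMap ℝ ℂ)) ≤
        sigmaMax (transferFn A B C D (Complex.exp ((θ : ℂ) * Complex.I))) := by
  have hsig : ∀ M : Matrix (Fin k) (Fin l) ℂ, sigmaMax M = ‖M‖ := fun M => rfl
  let L : Matrix (Fin n) (Fin n) ℂ →ₗ[ℂ] Matrix (Fin k) (Fin l) ℂ :=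
    { toFun := fun X => C.map (algebraMap ℝ ℂ) * X * B.map (algebraMap ℝ ℂ)
      map_add' := by intro X Y; rw [Matrix.mul_add, Matrix.add_mul]
      map_smul' := by intro c X; simp }
  let f : ℂ → Matrix (Fin k) (Fin l) ℂ := fun w =>
    LinearMap.toContinuousLinearMap L (w • Ring.inverse (1 - w • A.map (algebraMap ℝ ℂ)))
      + D.map (algebraMap ℝ ℂ)
  have hf : ∀ z : ℂ, 1 ≤ ‖z‖ → transferFn A B C D z = f z⁻¹ := by
    intro z hz
    have hz0 : z ≠ 0 := by rintro rfl; simp at hz; linarith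
    have hw : ‖z⁻¹‖ ≤ 1 := by rw [norm_inv]; exact inv_le_one_of_one_le₀ hz
    have hu := schur_isUnit' hA hw
    have : (z • (1 : Matrix (Fin n) (Fin n) ℂ) - A.map (algebraMap ℝ ℂ))⁻¹ =
        z⁻¹ • (1 - z⁻¹ • A.map (algebraMap ℝ ℂ))⁻¹ := by
      apply Matrix.inv_eq_right_inv
      have h2 : z • (1 : Matrix (Fin n) (Fin n) ℂ) - A.map (algebraMap ℝ ℂ) =
          z • (1 - z⁻¹ • A.map (algebraMap ℝ ℂ)) := by
        rw [smul_sub, smul_smul, mul_inv_cancel₀ hz0, one_smul]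
      rw [h2, Matrix.smul_mul, Matrix.mul_smul, smul_smul, mul_inv_cancel₀ hz0, one_smul,
        Matrix.mul_nonsing_inv _ ((Matrix.isUnit_iff_isUnit_det _).1 hu)]
    unfold transferFn
    rw [this, Matrix.nonsing_inv_eq_ringInverse]
    rfl
  have hd : ∀ w : ℂ, ‖w‖ ≤ 1 → DifferentiableAt ℂ f w := by
    intro w hw
    have hu := schur_isUnit' hA hw
    have h1 : DifferentiableAt ℂ (fun w : ℂ => Ring.inverse ((1 : Matrix (Fin n) (Fin n) ℂ) - w • A.map (algebraMap ℝ ℂ))) w := by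
      have := differentiableAt_inverse (𝕜 := ℂ) hu
      exact DifferentiableAt.comp (g := Ring.inverse) w this (by fun_prop)
    have h2 : DifferentiableAt ℂ (fun w : ℂ => w • Ring.inverse ((1 : Matrix (Fin n) (Fin n) ℂ) - w • A.map (algebraMap ℝ ℂ))) w :=
      DifferentiableAt.fun_smul differentiableAt_id h1
    exact DifferentiableAt.add_const _
      (((LinearMap.toContinuousLinearMap L).differentiableAt).comp w h2)
  have hdc : DiffContOnCl ℂ f (Metric.ball 0 1) := by
    apply DifferentiableOn.diffContOnCl
    rw [closure_ball _ one_ne_zero]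
    intro w hw
    exact (hd w (by simpa using hw)).differentiableWithinAt
  obtain ⟨w, hw, hmax⟩ := Complex.exists_mem_frontier_isMaxOn_norm Metric.isBounded_ball
    ⟨0, by simp⟩ hdc
  rw [frontier_ball _ one_ne_zero] at hw
  rw [closure_ball _ one_ne_zero] at hmax
  have hw1 : ‖w‖ = 1 := by simpa using hw
  obtain ⟨θ, hθ, hexp⟩ : ∃ θ ∈ Set.Icc (0 : ℝ) (2 * Real.pi), Complex.exp ((θ : ℂ) * Complex.I) = w⁻¹ := by
    have hn : ‖w⁻¹‖ = 1 := by simp [hw1]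
    have he : Complex.exp ((Complex.arg w⁻¹ : ℂ) * Complex.I) = w⁻¹ := by
      have := Complex.norm_mul_exp_arg_mul_I w⁻¹
      rwa [hn, Complex.ofReal_one, one_mul] at this
    have hle := Complex.arg_le_pi w⁻¹
    have hge := Complex.neg_pi_lt_arg w⁻¹
    by_cases h0 : 0 ≤ Complex.arg w⁻¹
    · exact ⟨_, ⟨h0, by linarith [Real.pi_pos]⟩, he⟩
    · refine ⟨Complex.arg w⁻¹ + 2 * Real.pi, ⟨by linarith, by linarith⟩, ?_⟩
      push_cast
      rw [add_mul, Complex.exp_add, Complex.exp_two_pi_mul_I, mul_one, he]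
  have hfw : transferFn A B C D (Complex.exp ((θ : ℂ) * Complex.I)) = f w := by
    rw [hexp, hf _ (by simp [hw1]), inv_inv]
  refine ⟨θ, hθ, ?_, ?_⟩
  · intro z hz
    rw [hfw, hf z hz, hsig, hsig]
    exact hmax (by simpa using inv_le_one_of_one_le₀ hz)
  · rw [hfw, hsig, hsig]
    have h0 : f 0 = D.map (algebraMap ℝ ℂ) := by
      show L _ + _ = _
      simp
    rw [← h0]
    exact hmax (by simp)

lemma isUnit_of_inj {k : Type*} [Fintype k] [DecidableEq k] {M : Matrix k k ℂ}
    (h : ∀ x, M *ᵥ x = 0 → x = 0) : IsUnit M := by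
  rw [← Matrix.mulVec_injective_iff_isUnit]
  intro x y hxy
  have := h (x - y) (by rw [Matrix.mulVec_sub]; exact sub_eq_zero.2 hxy)
  exact sub_eq_zero.1 this

lemma isUnit_mapC_iff {k : Type*} [Fintype k] [DecidableEq k] (M : Matrix k k ℝ) :
    IsUnit (M.map (algebraMap ℝ ℂ)) ↔ IsUnit M := by
  rw [Matrix.isUnit_iff_isUnit_det, Matrix.isUnit_iff_isUnit_det]
  have : (M.map (algebraMap ℝ ℂ)).det = algebraMap ℝ ℂ M.det :=
    ((algebraMap ℝ ℂ).map_det M).symm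
  rw [this, isUnit_iff_ne_zero, isUnit_iff_ne_zero]
  simp

section loop
variable {n m nv nw : ℕ}
    (A : Matrix (Fin n) (Fin n) ℝ) (Bw : Matrix (Fin n) (Fin nw) ℝ)
    (Cv : Matrix (Fin nv) (Fin n) ℝ) (Dvw : Matrix (Fin nv) (Fin nw) ℝ)
    (AΔ : Matrix (Fin m) (Fin m) ℝ) (BΔ : Matrix (Fin m) (Fin nv) ℝ)
    (CΔ : Matrix (Fin nw) (Fin m) ℝ) (DΔ : Matrix (Fin nw) (Fin nv) ℝ)

lemma loop_unit (h : IsUnit ((1 : Matrix (Fin nv) (Fin nv) ℝ) - Dvw * DΔ)) :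
    IsUnit (Matrix.fromBlocks (1 : Matrix (Fin nv) (Fin nv) ℝ) (-Dvw) (-DΔ)
        (1 : Matrix (Fin nw) (Fin nw) ℝ)) := by
  rw [Matrix.isUnit_iff_isUnit_det, Matrix.det_fromBlocks_one₂₂, ← Matrix.isUnit_iff_isUnit_det]
  simpa using h

lemma loop_exists (h : IsUnit ((1 : Matrix (Fin nv) (Fin nv) ℝ) - Dvw * DΔ))
    (x : Fin n → ℂ) (ξ : Fin m → ℂ) : ∃ (v : Fin nv → ℂ) (w : Fin nw → ℂ),
      v = Cv.map (algebraMap ℝ ℂ) *ᵥ x + Dvw.map (algebraMap ℝ ℂ) *ᵥ w ∧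
      w = CΔ.map (algebraMap ℝ ℂ) *ᵥ ξ + DΔ.map (algebraMap ℝ ℂ) *ᵥ v := by
  have hu := (isUnit_mapC_iff _).2 (loop_unit Dvw DΔ h)
  obtain ⟨y, hy⟩ := (Matrix.mulVec_surjective_iff_isUnit.2 hu)
    (Sum.elim (Cv.map (algebraMap ℝ ℂ) *ᵥ x) (CΔ.map (algebraMap ℝ ℂ) *ᵥ ξ))
  refine ⟨y ∘ Sum.inl, y ∘ Sum.inr, ?_, ?_⟩
  · have := congrArg (fun g => g ∘ Sum.inl) hy
    simp only [Matrix.fromBlocks_map, Matrix.fromBlocks_mulVec, Sum.elim_comp_inl] at this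
    rw [← this]
    simp [Matrix.map_neg, Matrix.neg_mulVec]
  · have := congrArg (fun g => g ∘ Sum.inr) hy
    simp only [Matrix.fromBlocks_map, Matrix.fromBlocks_mulVec, Sum.elim_comp_inr] at this
    rw [← this]
    simp [Matrix.map_neg, Matrix.neg_mulVec]

lemma loop_mulVec (h : IsUnit ((1 : Matrix (Fin nv) (Fin nv) ℝ) - Dvw * DΔ))
    (x : Fin n → ℂ) (ξ : Fin m → ℂ) (v : Fin nv → ℂ) (w : Fin nw → ℂ)
    (hv : v = Cv.map (algebraMap ℝ ℂ) *ᵥ x + Dvw.map (algebraMap ℝ ℂ) *ᵥ w)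
    (hw : w = CΔ.map (algebraMap ℝ ℂ) *ᵥ ξ + DΔ.map (algebraMap ℝ ℂ) *ᵥ v) :
    (interconnectA A Bw Cv Dvw AΔ BΔ CΔ DΔ).map (algebraMap ℝ ℂ) *ᵥ Sum.elim x ξ =
      Sum.elim (A.map (algebraMap ℝ ℂ) *ᵥ x + Bw.map (algebraMap ℝ ℂ) *ᵥ w)
        (AΔ.map (algebraMap ℝ ℂ) *ᵥ ξ + BΔ.map (algebraMap ℝ ℂ) *ᵥ v) := by
  have hu := loop_unit Dvw DΔ h
  set E := Matrix.fromBlocks (1 : Matrix (Fin nv) (Fin nv) ℝ) (-Dvw) (-DΔ)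
        (1 : Matrix (Fin nw) (Fin nw) ℝ) with hE
  have h1 : E⁻¹.map (algebraMap ℝ ℂ) * E.map (algebraMap ℝ ℂ) = 1 := by
    rw [← Matrix.map_mul, Matrix.nonsing_inv_mul _ ((Matrix.isUnit_iff_isUnit_det _).1 hu)]
    simp
  have h2 : E.map (algebraMap ℝ ℂ) *ᵥ Sum.elim v w =
      Sum.elim (Cv.map (algebraMap ℝ ℂ) *ᵥ x) (CΔ.map (algebraMap ℝ ℂ) *ᵥ ξ) := by
    rw [hE, Matrix.fromBlocks_map, Matrix.fromBlocks_mulVec]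
    congr 1
    · nth_rewrite 1 [hv]
      simp [Matrix.map_neg, Matrix.neg_mulVec]
    · nth_rewrite 2 [hw]
      simp [Matrix.map_neg, Matrix.neg_mulVec]
  have h3 : E⁻¹.map (algebraMap ℝ ℂ) *ᵥ
      Sum.elim (Cv.map (algebraMap ℝ ℂ) *ᵥ x) (CΔ.map (algebraMap ℝ ℂ) *ᵥ ξ) = Sum.elim v w := by
    rw [← h2, Matrix.mulVec_mulVec, h1, Matrix.one_mulVec]
  unfold interconnectA
  rw [← hE, Matrix.map_add _ (by simp), Matrix.add_mulVec, Matrix.map_mul, Matrix.map_mul,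
    ← Matrix.mulVec_mulVec, ← Matrix.mulVec_mulVec]
  have h4 : (Matrix.fromBlocks Cv 0 0 CΔ).map (algebraMap ℝ ℂ) *ᵥ Sum.elim x ξ =
      Sum.elim (Cv.map (algebraMap ℝ ℂ) *ᵥ x) (CΔ.map (algebraMap ℝ ℂ) *ᵥ ξ) := by
    rw [Matrix.fromBlocks_map, Matrix.fromBlocks_mulVec]
    simp
  rw [h4, h3, Matrix.fromBlocks_map, Matrix.fromBlocks_mulVec, Matrix.fromBlocks_map,
    Matrix.fromBlocks_mulVec]
  ext i
  rcases i with i | i <;> simp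

end loop

lemma state_eq {n k l : ℕ} {A : Matrix (Fin n) (Fin n) ℝ} (B : Matrix (Fin n) (Fin l) ℝ)
    (C : Matrix (Fin k) (Fin n) ℝ) (D : Matrix (Fin k) (Fin l) ℝ) {z : ℂ}
    (hu : IsUnit (z • (1 : Matrix (Fin n) (Fin n) ℂ) - A.map (algebraMap ℝ ℂ)))
    {x : Fin n → ℂ} {w : Fin l → ℂ}
    (hx : A.map (algebraMap ℝ ℂ) *ᵥ x + B.map (algebraMap ℝ ℂ) *ᵥ w = z • x) :
    C.map (algebraMap ℝ ℂ) *ᵥ x + D.map (algebraMap ℝ ℂ) *ᵥ w = transferFn A B C D z *ᵥ w ∧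
      (w = 0 → x = 0) := by
  have h1 : (z • (1 : Matrix (Fin n) (Fin n) ℂ) - A.map (algebraMap ℝ ℂ)) *ᵥ x =
      B.map (algebraMap ℝ ℂ) *ᵥ w := by
    rw [Matrix.sub_mulVec, Matrix.smul_mulVec, Matrix.one_mulVec, ← hx]; simp
  have h2 : x = (z • (1 : Matrix (Fin n) (Fin n) ℂ) - A.map (algebraMap ℝ ℂ))⁻¹ *ᵥ
      (B.map (algebraMap ℝ ℂ) *ᵥ w) := by
    rw [← h1, Matrix.mulVec_mulVec,
      Matrix.nonsing_inv_mul _ ((Matrix.isUnit_iff_isUnit_det _).1 hu), Matrix.one_mulVec]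
  constructor
  · unfold transferFn
    rw [Matrix.add_mulVec, ← Matrix.mulVec_mulVec, ← Matrix.mulVec_mulVec, ← h2]
  · rintro rfl
    rw [h2]; simp

lemma state_exists {n l : ℕ} {A : Matrix (Fin n) (Fin n) ℝ} (B : Matrix (Fin n) (Fin l) ℝ)
    {z : ℂ}
    (hu : IsUnit (z • (1 : Matrix (Fin n) (Fin n) ℂ) - A.map (algebraMap ℝ ℂ)))
    (w : Fin l → ℂ) :
    ∃ x, A.map (algebraMap ℝ ℂ) *ᵥ x + B.map (algebraMap ℝ ℂ) *ᵥ w = z • x := by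
  obtain ⟨x, hx⟩ := (Matrix.mulVec_surjective_iff_isUnit.2 hu) (B.map (algebraMap ℝ ℂ) *ᵥ w)
  refine ⟨x, ?_⟩
  rw [← hx, Matrix.sub_mulVec, Matrix.smul_mulVec, Matrix.one_mulVec]; simp

section loop2
variable {n m nv nw : ℕ}
    (A : Matrix (Fin n) (Fin n) ℝ) (Bw : Matrix (Fin n) (Fin nw) ℝ)
    (Cv : Matrix (Fin nv) (Fin n) ℝ) (Dvw : Matrix (Fin nv) (Fin nw) ℝ)
    (AΔ : Matrix (Fin m) (Fin m) ℝ) (BΔ : Matrix (Fin m) (Fin nv) ℝ)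
    (CΔ : Matrix (Fin nw) (Fin m) ℝ) (DΔ : Matrix (Fin nw) (Fin nv) ℝ)

lemma loop_stable (hA : SchurStable A) (hAΔ : SchurStable AΔ)
    (h : IsUnit ((1 : Matrix (Fin nv) (Fin nv) ℝ) - Dvw * DΔ))
    (hz : ∀ z : ℂ, 1 ≤ ‖z‖ → ∀ v : Fin nv → ℂ,
      v = transferFn A Bw Cv Dvw z *ᵥ (transferFn AΔ BΔ CΔ DΔ z *ᵥ v) → v = 0) :
    SchurStable (interconnectA A Bw Cv Dvw AΔ BΔ CΔ DΔ) := by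
  intro μ hμ
  by_contra hcon
  have h1 : 1 ≤ ‖μ‖ := not_lt.1 hcon
  rw [spectrum.mem_iff, Algebra.algebraMap_eq_smul_one] at hμ
  apply hμ
  apply isUnit_of_inj
  intro X hX
  rw [Matrix.sub_mulVec, Matrix.smul_mulVec, Matrix.one_mulVec, sub_eq_zero] at hX
  obtain ⟨x, ξ, rfl⟩ : ∃ x ξ, X = Sum.elim x ξ := ⟨X ∘ Sum.inl, X ∘ Sum.inr, by simp⟩
  obtain ⟨v, w, hv, hw⟩ := loop_exists Cv Dvw CΔ DΔ h x ξ
  rw [loop_mulVec A Bw Cv Dvw AΔ BΔ CΔ DΔ h x ξ v w hv hw] at hX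
  have e1 := congrArg (fun g => g ∘ Sum.inl) hX
  have e2 := congrArg (fun g => g ∘ Sum.inr) hX
  simp only [Sum.elim_comp_inl, Sum.elim_comp_inr] at e1 e2
  obtain ⟨f1, f2⟩ := state_eq (x := x) Bw Cv Dvw (schur_isUnit hA h1) e1.symm
  obtain ⟨g1, g2⟩ := state_eq (x := ξ) BΔ CΔ DΔ (schur_isUnit hAΔ h1) e2.symm
  rw [← hv] at f1
  rw [← hw] at g1
  have hv0 : v = 0 := hz μ h1 v (by rw [← g1]; exact f1)
  have hw0 : w = 0 := by rw [g1, hv0]; simp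
  rw [f2 hw0, g2 hv0]
  ext i; rcases i with i | i <;> rfl

lemma loop_inj (hA : SchurStable A) (hAΔ : SchurStable AΔ)
    (h : IsUnit ((1 : Matrix (Fin nv) (Fin nv) ℝ) - Dvw * DΔ))
    (hs : SchurStable (interconnectA A Bw Cv Dvw AΔ BΔ CΔ DΔ))
    (z : ℂ) (h1 : 1 ≤ ‖z‖) (v : Fin nv → ℂ)
    (hv : v = transferFn A Bw Cv Dvw z *ᵥ (transferFn AΔ BΔ CΔ DΔ z *ᵥ v)) : v = 0 := by
  set w := transferFn AΔ BΔ CΔ DΔ z *ᵥ v with hw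
  obtain ⟨x, hx⟩ := state_exists Bw (schur_isUnit hA h1) w
  obtain ⟨ξ, hξ⟩ := state_exists BΔ (schur_isUnit hAΔ h1) v
  obtain ⟨f1, f2⟩ := state_eq (x := x) Bw Cv Dvw (schur_isUnit hA h1) hx
  obtain ⟨g1, g2⟩ := state_eq (x := ξ) BΔ CΔ DΔ (schur_isUnit hAΔ h1) hξ
  rw [← hv] at f1
  rw [← hw] at g1
  have hX := loop_mulVec A Bw Cv Dvw AΔ BΔ CΔ DΔ h x ξ v w f1.symm g1.symm
  rw [hx, hξ] at hX
  have hu := schur_isUnit hs h1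
  have hX0 : Sum.elim x ξ = 0 := by
    apply (Matrix.mulVec_injective_iff_isUnit.2 hu)
    rw [Matrix.sub_mulVec, Matrix.smul_mulVec, Matrix.one_mulVec, hX, Matrix.mulVec_zero]
    ext i; rcases i with i | i <;> simp
  have hx0 : x = 0 := by
    have := congrArg (fun g => g ∘ Sum.inl) hX0
    simpa using this
  have hξ0 : ξ = 0 := by
    have := congrArg (fun g => g ∘ Sum.inr) hX0
    simpa using this
  subst hx0 hξ0
  rw [Matrix.mulVec_zero, zero_add] at f1 g1
  have hu2 := (isUnit_mapC_iff _).2 h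
  apply (Matrix.mulVec_injective_iff_isUnit.2 hu2)
  rw [Matrix.map_sub _ (by simp), Matrix.map_mul, Matrix.sub_mulVec, ← Matrix.mulVec_mulVec, g1, f1]
  simp

end loop2

lemma scalar_interp (z0 : ℂ) (h0 : ‖z0‖ = 1) (c : ℂ) (h : z0.im ≠ 0 ∨ c.im = 0) :
    ∃ a κ δ : ℝ, |a| < 1 ∧ (∀ z : ℂ, ‖z‖ = 1 → ‖(δ : ℂ) + κ / (z - a)‖ = ‖c‖) ∧
      (δ : ℂ) + κ / (z0 - a) = c := by
  by_cases hc : c.im = 0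
  · have : ((c.re : ℝ) : ℂ) = c := by apply Complex.ext <;> simp [hc]
    refine ⟨0, 0, c.re, by simp, fun z _ => by simp [this], by simp [this]⟩
  have hz : z0.im ≠ 0 := h.resolve_right hc
  have hc0 : c ≠ 0 := by rintro rfl; simp at hc
  have hcn : ‖c‖ ≠ 0 := by simpa using hc0
  obtain ⟨r, hr, hsgn⟩ : ∃ r : ℝ, |r| = ‖c‖ ∧ z0.im * (c.im / r) < 0 := by
    have hp : 0 < ‖c‖ := norm_pos_iff.2 hc0
    rcases lt_or_gt_of_ne (mul_ne_zero hz hc) with hl | hg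
    · refine ⟨‖c‖, by simp, ?_⟩
      rw [← mul_div_assoc]; exact div_neg_of_neg_of_pos hl hp
    · refine ⟨-‖c‖, by simp, ?_⟩
      rw [← mul_div_assoc]; exact div_neg_of_pos_of_neg hg (by linarith)
  have hr0 : r ≠ 0 := by rintro rfl; simp at hr; exact hcn hr.symm
  obtain ⟨p, q⟩ := z0
  simp only at hz hsgn
  have hpq : p ^ 2 + q ^ 2 = 1 := by
    have := Complex.sq_norm (⟨p, q⟩ : ℂ)
    rw [h0, Complex.normSq_mk] at this; linarith
  have hxy : (c.re / r) ^ 2 + (c.im / r) ^ 2 = 1 := by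
    have := Complex.sq_norm c
    rw [← hr, sq_abs, Complex.normSq_apply] at this
    field_simp; linarith
  set x := c.re / r with hx
  set y := c.im / r with hy
  have hcx : c = (r : ℂ) * (⟨x, y⟩ : ℂ) := by
    apply Complex.ext <;> simp [hx, hy] <;> field_simp
  have hden : 0 < 1 - p * x - q * y := by
    nlinarith [sq_nonneg (p - x), sq_nonneg q, sq_nonneg y]
  set a := (p - x) / (1 - p * x - q * y) with ha
  have hae : a * (1 - p * x - q * y) = p - x := by rw [ha]; field_simp
  have hsq : (p - x) ^ 2 = (1 - p * x + q * y) * (1 - p * x - q * y) := by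
    linear_combination (1 - x ^ 2) * hpq + q^2 * hxy
  have hae2 : a ^ 2 * (1 - p * x - q * y) = 1 - p * x + q * y := by
    have : (a ^ 2 * (1 - p * x - q * y)) * (1 - p * x - q * y) = (1 - p * x + q * y) * (1 - p * x - q * y) := by
      rw [← hsq, ← hae]; ring
    exact mul_right_cancel₀ hden.ne' this
  have ha1 : a ^ 2 < 1 := by
    by_contra hcon
    nlinarith [mul_nonneg (sub_nonneg.2 (not_lt.1 hcon)) hden.le]
  have habs : |a| < 1 := by rw [← sq_lt_one_iff_abs_lt_one]; exact ha1
  have hne : ∀ z : ℂ, ‖z‖ = 1 → z - (a : ℂ) ≠ 0 := by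
    intro z hz h
    have : z = a := sub_eq_zero.1 h
    rw [this, Complex.norm_real, Real.norm_eq_abs] at hz
    linarith
  have hform : ∀ z : ℂ, ‖z‖ = 1 → ((-(r * a) : ℝ) : ℂ) + ((r * (1 - a ^ 2) : ℝ) : ℂ) / (z - a) =
      r * ((1 - a * z) / (z - a)) := by
    intro z hz
    have := hne z hz
    push_cast
    field_simp
    ring
  refine ⟨a, r * (1 - a ^ 2), -(r * a), habs, ?_, ?_⟩
  · intro z hz
    rw [hform z hz, norm_mul, norm_div]
    have : ‖1 - (a : ℂ) * z‖ = ‖z - a‖ := by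
      rw [← sq_eq_sq₀ (norm_nonneg _) (norm_nonneg _), Complex.sq_norm, Complex.sq_norm,
        Complex.normSq_apply, Complex.normSq_apply]
      have h2 := Complex.sq_norm z
      rw [hz, Complex.normSq_apply] at h2
      simp
      linear_combination (a^2 - 1) * (-h2)
    rw [this, div_self (norm_ne_zero_iff.2 (hne z hz)), mul_one, Complex.norm_real, Real.norm_eq_abs, hr]
  · rw [hform _ h0, hcx]
    congr 1
    rw [div_eq_iff (hne _ h0)]
    have e1 : a * (y - q) = x * q + y * p := by
      have : (a * (y - q)) * (1 - p * x - q * y) = (x * q + y * p) * (1 - p * x - q * y) := by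
        linear_combination (y - q) * hae + p * q * hxy + x * y * hpq
      exact mul_right_cancel₀ hden.ne' this
    have e2 : a * (x - p) = x * p - y * q - 1 := by
      have : (a * (x - p)) * (1 - p * x - q * y) = (x * p - y * q - 1) * (1 - p * x - q * y) := by
        linear_combination (x - p) * hae - hsq
      exact mul_right_cancel₀ hden.ne' this
    apply Complex.ext
    · simp; linarith
    · simp; linarith

lemma interp {nv nw : ℕ} (z0 : ℂ) (h0 : ‖z0‖ = 1) (w : Fin nw → ℂ) (v : Fin nv → ℂ)
    (hle : nsq w ≤ nsq v) (h : z0.im ≠ 0 ∨ ((∀ i, (w i).im = 0) ∧ ∀ j, (v j).im = 0)) :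
    ∃ (m : ℕ) (AΔ : Matrix (Fin m) (Fin m) ℝ) (BΔ : Matrix (Fin m) (Fin nv) ℝ)
      (CΔ : Matrix (Fin nw) (Fin m) ℝ) (DΔ : Matrix (Fin nw) (Fin nv) ℝ),
      SchurStable AΔ ∧ (∀ z : ℂ, ‖z‖ = 1 → sigmaMax (transferFn AΔ BΔ CΔ DΔ z) ≤ 1) ∧
      transferFn AΔ BΔ CΔ DΔ z0 *ᵥ v = w := by
  have H1 := fun i => scalar_interp z0 h0 (w i / (nsq v : ℂ)) (by
    rcases h with h | h
    · exact Or.inl h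
    · right; rw [Complex.div_ofReal_im, h.1 i, zero_div])
  have H2 := fun j => scalar_interp z0 h0 (star (v j)) (by
    rcases h with h | h
    · exact Or.inl h
    · right; simp [h.2 j])
  choose a1 κ1 δ1 ha1 hn1 he1 using H1
  choose a2 κ2 δ2 ha2 hn2 he2 using H2
  let e : Fin nw ⊕ Fin nv ≃ Fin (nw + nv) := finSumFinEquiv
  let A0 : Matrix (Fin nw ⊕ Fin nv) (Fin nw ⊕ Fin nv) ℝ :=
    Matrix.fromBlocks (Matrix.diagonal a1) (Matrix.vecMulVec κ1 κ2) 0 (Matrix.diagonal a2)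
  let B0 : Matrix (Fin nw ⊕ Fin nv) (Fin nv) ℝ := Matrix.fromRows (Matrix.vecMulVec κ1 δ2) 1
  let C0 : Matrix (Fin nw) (Fin nw ⊕ Fin nv) ℝ := Matrix.fromCols 1 (Matrix.vecMulVec δ1 κ2)
  let D0 : Matrix (Fin nw) (Fin nv) ℝ := Matrix.vecMulVec δ1 δ2
  have hne : ∀ (a : ℝ) (z : ℂ), |a| < 1 → 1 ≤ ‖z‖ → z - (a : ℂ) ≠ 0 := by
    intro a z ha hz h
    have : z = a := sub_eq_zero.1 h
    rw [this, Complex.norm_real, Real.norm_eq_abs] at hz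
    linarith
  have hS : SchurStable (A0.submatrix e.symm e.symm) := by
    intro μ hμ
    by_contra hcon
    have h1 : 1 ≤ ‖μ‖ := not_lt.1 hcon
    rw [spectrum.mem_iff, Algebra.algebraMap_eq_smul_one] at hμ
    apply hμ
    have : μ • (1 : Matrix (Fin (nw + nv)) (Fin (nw + nv)) ℂ) -
        (A0.submatrix e.symm e.symm).map (algebraMap ℝ ℂ) =
        (μ • (1 : Matrix (Fin nw ⊕ Fin nv) (Fin nw ⊕ Fin nv) ℂ) -
          A0.map (algebraMap ℝ ℂ)).submatrix e.symm e.symm := by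
      ext i j
      simp [Matrix.one_apply]
    rw [this, Matrix.isUnit_submatrix_equiv]
    have h2 : μ • (1 : Matrix (Fin nw ⊕ Fin nv) (Fin nw ⊕ Fin nv) ℂ) -
          A0.map (algebraMap ℝ ℂ) = Matrix.fromBlocks
          (Matrix.diagonal fun i => μ - a1 i) (-(Matrix.vecMulVec κ1 κ2).map (algebraMap ℝ ℂ)) 0
          (Matrix.diagonal fun j => μ - a2 j) := by
      ext i j
      rcases i with i | i <;> rcases j with j | j <;>
        simp [A0, Matrix.one_apply, Matrix.diagonal_apply] <;> split_ifs <;> simp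
    rw [h2, Matrix.isUnit_fromBlocks_zero₂₁, Matrix.isUnit_diagonal, Matrix.isUnit_diagonal,
      Pi.isUnit_iff, Pi.isUnit_iff]
    exact ⟨fun i => isUnit_iff_ne_zero.2 (hne _ _ (ha1 i) h1),
      fun i => isUnit_iff_ne_zero.2 (hne _ _ (ha2 i) h1)⟩
  have hT : ∀ z : ℂ, ‖z‖ = 1 → ∀ u : Fin nv → ℂ,
      transferFn (A0.submatrix e.symm e.symm) (B0.submatrix e.symm id) (C0.submatrix id e.symm) D0 z *ᵥ u
      = (∑ j, ((δ2 j : ℂ) + κ2 j / (z - a2 j)) * u j) • fun i => ((δ1 i : ℂ) + κ1 i / (z - a1 i)) := by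
    intro z hz u
    set y := ∑ j, ((δ2 j : ℂ) + κ2 j / (z - a2 j)) * u j with hy
    have hy' : y = ∑ j, (κ2 j : ℂ) * (u j / (z - a2 j)) + ∑ j, (δ2 j : ℂ) * u j := by
      rw [hy, ← Finset.sum_add_distrib]
      refine Finset.sum_congr rfl fun j _ => ?_
      ring
    let s : Fin nw ⊕ Fin nv → ℂ := Sum.elim (fun i => κ1 i * y / (z - a1 i)) (fun j => u j / (z - a2 j))
    have hst : (A0.submatrix e.symm e.symm).map (algebraMap ℝ ℂ) *ᵥ (s ∘ e.symm) +
        (B0.submatrix e.symm id).map (algebraMap ℝ ℂ) *ᵥ u = z • (s ∘ e.symm) := by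
      have h1 : (A0.submatrix e.symm e.symm).map (algebraMap ℝ ℂ) *ᵥ (s ∘ e.symm) =
          (A0.map (algebraMap ℝ ℂ) *ᵥ s) ∘ e.symm := by
        rw [← Matrix.submatrix_map, Matrix.submatrix_mulVec_equiv]
        congr 2
        ext i; simp
      have h2 : (B0.submatrix e.symm id).map (algebraMap ℝ ℂ) *ᵥ u =
          (B0.map (algebraMap ℝ ℂ) *ᵥ u) ∘ e.symm := rfl
      rw [h1, h2]
      suffices hh : A0.map (algebraMap ℝ ℂ) *ᵥ s + B0.map (algebraMap ℝ ℂ) *ᵥ u = z • s by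
        have := congrArg (fun g => g ∘ e.symm) hh
        exact this
      ext i
      rcases i with i | i
      · have hzi := hne _ z (ha1 i) hz.ge
        simp [A0, B0, s, Matrix.mulVec, dotProduct, Matrix.diagonal_apply, Matrix.vecMulVec_apply,
          apply_ite, ite_mul]
        have : (∑ j, (κ1 i : ℂ) * κ2 j * (u j / (z - a2 j))) + ∑ j, (κ1 i : ℂ) * δ2 j * u j = κ1 i * y := by
          rw [hy', mul_add, Finset.mul_sum, Finset.mul_sum]
          simp only [mul_assoc]
        rw [add_assoc, this]
        field_simp
        ring
      · have hzi := hne _ z (ha2 i) hz.ge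
        simp [A0, B0, s, Matrix.mulVec, dotProduct, Matrix.diagonal_apply, Matrix.vecMulVec_apply,
          apply_ite, ite_mul, Matrix.one_apply]
        field_simp
        ring
    obtain ⟨f1, -⟩ := state_eq (B0.submatrix e.symm id) (C0.submatrix id e.symm) D0
      (schur_isUnit hS hz.ge) hst
    rw [← f1]
    have h1 : (C0.submatrix id e.symm).map (algebraMap ℝ ℂ) *ᵥ (s ∘ e.symm) =
          (C0.map (algebraMap ℝ ℂ) *ᵥ s) := by
        rw [← Matrix.submatrix_map, Matrix.submatrix_mulVec_equiv]
        ext i; simp [Function.comp_assoc]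
    rw [h1]
    ext i
    simp [C0, D0, s, Matrix.mulVec, dotProduct, Matrix.vecMulVec_apply,
          apply_ite, ite_mul, Matrix.one_apply]
    have : (∑ j, (δ1 i : ℂ) * κ2 j * (u j / (z - a2 j))) + ∑ j, (δ1 i : ℂ) * δ2 j * u j = δ1 i * y := by
          rw [hy', mul_add, Finset.mul_sum, Finset.mul_sum]
          simp only [mul_assoc]
    rw [add_assoc, this]
    ring
  refine ⟨nw + nv, A0.submatrix e.symm e.symm, B0.submatrix e.symm id, C0.submatrix id e.symm, D0,
    hS, ?_, ?_⟩
  · intro z hz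
    rw [sigmaMax_le_one_iff]
    intro u
    rw [hT z hz u, nsq_smul]
    have h1 : nsq (fun i => ((δ1 i : ℂ) + κ1 i / (z - a1 i))) = nsq w / nsq v ^ 2 := by
      unfold nsq
      rw [Finset.sum_div]
      refine Finset.sum_congr rfl fun i _ => ?_
      rw [hn1 i z hz, norm_div, div_pow, Complex.norm_real, Real.norm_eq_abs, sq_abs]; rfl
    have h2 : ‖∑ j, ((δ2 j : ℂ) + κ2 j / (z - a2 j)) * u j‖ ^ 2 ≤ nsq v * nsq u := by
      have h3 : ‖∑ j, ((δ2 j : ℂ) + κ2 j / (z - a2 j)) * u j‖ ≤ ∑ j, ‖v j‖ * ‖u j‖ := by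
        refine (norm_sum_le _ _).trans (le_of_eq ?_)
        refine Finset.sum_congr rfl fun j _ => ?_
        rw [norm_mul, hn2 j z hz, norm_star]
      refine (pow_le_pow_left₀ (norm_nonneg _) h3 2).trans ?_
      exact Finset.sum_mul_sq_le_sq_mul_sq _ _ _
    rw [h1]
    rcases eq_or_lt_of_le (nsq_nonneg v) with hv | hv
    · rw [← hv]; simp [nsq_nonneg]
    · have h4 : 0 ≤ nsq w / nsq v ^ 2 := div_nonneg (nsq_nonneg _) (sq_nonneg _)
      refine (mul_le_mul_of_nonneg_right h2 h4).trans ?_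
      have : nsq v * nsq u * (nsq w / nsq v ^ 2) = nsq u * (nsq w / nsq v) := by
        field_simp
      rw [this]
      exact mul_le_of_le_one_right (nsq_nonneg _) ((div_le_one hv).2 hle)
  · rw [hT z0 h0 v]
    have h1 : ∑ j, ((δ2 j : ℂ) + κ2 j / (z0 - a2 j)) * v j = (nsq v : ℂ) := by
      unfold nsq
      push_cast
      refine Finset.sum_congr rfl fun j _ => ?_
      rw [he2 j]
      exact Complex.conj_mul' (v j)
    rw [h1]
    ext i
    simp only [Pi.smul_apply, he1 i, smul_eq_mul]
    rcases eq_or_lt_of_le (nsq_nonneg v) with hv | hv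
    · have : w = 0 := nsq_eq_zero (le_antisymm (by rw [hv]; exact hle) (nsq_nonneg _))
      rw [this]; simp
    · have : (nsq v : ℂ) ≠ 0 := by exact_mod_cast hv.ne'
      field_simp

lemma nsq_quad {k : Type*} [Fintype k] (x y : k → ℂ) :
    ∃ b : ℝ, ∀ s t : ℝ, nsq (s • x + t • y) = s ^ 2 * nsq x + s * t * b + t ^ 2 * nsq y := by
  refine ⟨∑ i, 2 * ((x i).re * (y i).re + (x i).im * (y i).im), fun s t => ?_⟩
  unfold nsq
  rw [Finset.mul_sum, Finset.mul_sum, Finset.mul_sum, ← Finset.sum_add_distrib,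
    ← Finset.sum_add_distrib]
  refine Finset.sum_congr rfl fun i _ => ?_
  rw [Complex.sq_norm, Complex.sq_norm, Complex.sq_norm, Complex.normSq_apply,
    Complex.normSq_apply, Complex.normSq_apply]
  simp
  ring

lemma nsq_continuous {k : Type*} [Fintype k] : Continuous (nsq : (k → ℂ) → ℝ) := by
  unfold nsq; fun_prop

lemma s_lemma_lin {V : Type*} [NormedAddCommGroup V] [NormedSpace ℝ V] [FiniteDimensional ℝ V]
    {kv kw ke kd : Type*} [Fintype kv] [Fintype kw] [Fintype ke] [Fintype kd]
    (Lv : V →ₗ[ℝ] (kv → ℂ)) (Lw : V →ₗ[ℝ] (kw → ℂ)) (Le : V →ₗ[ℝ] (ke → ℂ)) (Ld : V →ₗ[ℝ] (kd → ℂ))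
    (hno : ∀ x ≠ 0, nsq (Lw x) ≤ nsq (Lv x) → nsq (Le x) < nsq (Ld x)) :
    ∃ d : ℝ, 0 < d ∧ ∀ x ≠ 0,
      d * (nsq (Lv x) - nsq (Lw x)) + (nsq (Le x) - nsq (Ld x)) < 0 := by
  refine s_lemma (fun x => nsq (Lv x) - nsq (Lw x)) (fun x => nsq (Le x) - nsq (Ld x))
    ((nsq_continuous.comp Lv.continuous_of_finiteDimensional).sub
      (nsq_continuous.comp Lw.continuous_of_finiteDimensional))
    ((nsq_continuous.comp Le.continuous_of_finiteDimensional).sub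
      (nsq_continuous.comp Ld.continuous_of_finiteDimensional)) ?_ ?_ ?_
  · intro x y
    obtain ⟨b, hb⟩ := nsq_quad (Lv x) (Lv y)
    obtain ⟨b', hb'⟩ := nsq_quad (Lw x) (Lw y)
    refine ⟨b - b', fun s t => ?_⟩
    simp only [map_add, map_smul]
    rw [hb, hb']; ring
  · intro x y
    obtain ⟨b, hb⟩ := nsq_quad (Le x) (Le y)
    obtain ⟨b', hb'⟩ := nsq_quad (Ld x) (Ld y)
    refine ⟨b - b', fun s t => ?_⟩
    simp only [map_add, map_smul]
    rw [hb, hb']; ring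
  · intro x hx h
    have := hno x hx (by linarith)
    linarith

/-- complexification of a real vector -/
def rc {k : Type*} (x : k → ℝ) : k → ℂ := fun i => (x i : ℂ)

lemma rc_mulVec {k l : Type*} [Fintype l] (N : Matrix k l ℝ) (x : l → ℝ) :
    N.map (algebraMap ℝ ℂ) *ᵥ rc x = rc (N *ᵥ x) := by
  ext i
  simp [rc, Matrix.mulVec, dotProduct]

lemma rc_add {k : Type*} (x y : k → ℝ) : rc (x + y) = rc x + rc y := by
  ext i; simp [rc]

lemma nsq_rc_add {k : Type*} [Fintype k] (x y : k → ℝ) :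
    nsq (rc x + Complex.I • rc y) = nsq (rc x) + nsq (rc y) := by
  unfold nsq rc
  rw [← Finset.sum_add_distrib]
  refine Finset.sum_congr rfl fun i _ => ?_
  rw [Complex.sq_norm, Complex.sq_norm, Complex.sq_norm, Complex.normSq_apply,
    Complex.normSq_apply, Complex.normSq_apply]
  simp

lemma rc_decomp {k : Type*} (x : k → ℂ) :
    ∃ a b : k → ℝ, x = rc a + Complex.I • rc b := by
  refine ⟨fun i => (x i).re, fun i => (x i).im, ?_⟩
  ext i
  simp only [rc, Pi.add_apply, Pi.smul_apply, smul_eq_mul]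
  rw [mul_comm]; exact (Complex.re_add_im _).symm

def rcL {k : Type*} : (k → ℝ) →ₗ[ℝ] (k → ℂ) where
  toFun := rc
  map_add' := rc_add
  map_smul' c x := by ext i; simp [rc]

lemma core_real {nv nw ne nd : ℕ} (N11 : Matrix (Fin nv) (Fin nw) ℝ) (N12 : Matrix (Fin nv) (Fin nd) ℝ)
    (N21 : Matrix (Fin ne) (Fin nw) ℝ) (N22 : Matrix (Fin ne) (Fin nd) ℝ)
    (hno : ∀ (w : Fin nw → ℝ) (d : Fin nd → ℝ), (w, d) ≠ 0 →
      nsq (rc w) ≤ nsq (rc (N11 *ᵥ w + N12 *ᵥ d)) →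
      nsq (rc (N21 *ᵥ w + N22 *ᵥ d)) < nsq (rc d)) :
    ∃ s : ℝ, 0 < s ∧ ∀ (w : Fin nw → ℂ) (d : Fin nd → ℂ), (w, d) ≠ 0 →
      s * (nsq (N11.map (algebraMap ℝ ℂ) *ᵥ w + N12.map (algebraMap ℝ ℂ) *ᵥ d) - nsq w)
       + (nsq (N21.map (algebraMap ℝ ℂ) *ᵥ w + N22.map (algebraMap ℝ ℂ) *ᵥ d) - nsq d) < 0 := by
  obtain ⟨s, hs, H⟩ := s_lemma_lin (V := (Fin nw → ℝ) × (Fin nd → ℝ))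
    (rcL.comp (N11.mulVecLin.coprod N12.mulVecLin)) (rcL.comp (LinearMap.fst ℝ _ _))
    (rcL.comp (N21.mulVecLin.coprod N22.mulVecLin)) (rcL.comp (LinearMap.snd ℝ _ _))
    (by rintro ⟨w, d⟩ hx h; exact hno w d hx h)
  replace H : ∀ (w : Fin nw → ℝ) (d : Fin nd → ℝ), (w, d) ≠ 0 →
      s * (nsq (rc (N11 *ᵥ w + N12 *ᵥ d)) - nsq (rc w)) +
        (nsq (rc (N21 *ᵥ w + N22 *ᵥ d)) - nsq (rc d)) < 0 := fun w d h => H (w, d) h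
  have H0 : ∀ (w : Fin nw → ℝ) (d : Fin nd → ℝ),
      s * (nsq (rc (N11 *ᵥ w + N12 *ᵥ d)) - nsq (rc w)) +
        (nsq (rc (N21 *ᵥ w + N22 *ᵥ d)) - nsq (rc d)) ≤ 0 := by
    intro w d
    by_cases h : (w, d) = 0
    · obtain ⟨rfl, rfl⟩ := Prod.mk.inj h
      have : ∀ k : ℕ, nsq (rc (0 : Fin k → ℝ)) = 0 := by intro k; simp [nsq, rc]
      simp [this]
    · exact (H w d h).le
  refine ⟨s, hs, fun w d h => ?_⟩
  obtain ⟨a, b, rfl⟩ := rc_decomp w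
  obtain ⟨a', b', rfl⟩ := rc_decomp d
  have e : ∀ (k : ℕ) (P : Matrix (Fin k) (Fin nw) ℝ) (Q : Matrix (Fin k) (Fin nd) ℝ),
      P.map (algebraMap ℝ ℂ) *ᵥ (rc a + Complex.I • rc b) +
        Q.map (algebraMap ℝ ℂ) *ᵥ (rc a' + Complex.I • rc b') =
      rc (P *ᵥ a + Q *ᵥ a') + Complex.I • rc (P *ᵥ b + Q *ᵥ b') := by
    intro k P Q
    rw [Matrix.mulVec_add, Matrix.mulVec_add, Matrix.mulVec_smul, Matrix.mulVec_smul,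
      rc_mulVec, rc_mulVec, rc_mulVec, rc_mulVec, rc_add, rc_add, smul_add]
    abel
  rw [e, e, nsq_rc_add, nsq_rc_add, nsq_rc_add, nsq_rc_add]
  by_cases h1 : (a, a') = 0
  · have h2 : (b, b') ≠ 0 := by
      intro h2
      obtain ⟨rfl, rfl⟩ := Prod.mk.inj h1
      obtain ⟨rfl, rfl⟩ := Prod.mk.inj h2
      apply h
      ext i <;> simp [rc]
    have := H b b' h2
    have := H0 a a'
    linarith
  · have := H a a' h1
    have := H0 b b'
    linarith

lemma transfer_real {n : ℕ} {A : Matrix (Fin n) (Fin n) ℝ} (hA : SchurStable A)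
    (r : ℝ) (hr : 1 ≤ |r|) :
    ∃ Y : Matrix (Fin n) (Fin n) ℝ, ∀ {k l : ℕ} (B : Matrix (Fin n) (Fin l) ℝ)
    (C : Matrix (Fin k) (Fin n) ℝ) (D : Matrix (Fin k) (Fin l) ℝ),
    transferFn A B C D (r : ℂ) = (C * Y * B + D).map (algebraMap ℝ ℂ) := by
  have hu := schur_isUnit hA (z := (r : ℂ)) (by simpa using hr)
  have hm : ((r : ℂ) • (1 : Matrix (Fin n) (Fin n) ℂ) - A.map (algebraMap ℝ ℂ)) =
      (r • (1 : Matrix (Fin n) (Fin n) ℝ) - A).map (algebraMap ℝ ℂ) := by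
    ext i j
    simp [Matrix.one_apply, apply_ite]
  have hu' := hu
  rw [hm, isUnit_mapC_iff, Matrix.isUnit_iff_isUnit_det] at hu'
  refine ⟨(r • (1 : Matrix (Fin n) (Fin n) ℝ) - A)⁻¹, ?_⟩
  intro k l B C D
  have : ((r : ℂ) • (1 : Matrix (Fin n) (Fin n) ℂ) - A.map (algebraMap ℝ ℂ))⁻¹ =
      ((r • (1 : Matrix (Fin n) (Fin n) ℝ) - A)⁻¹).map (algebraMap ℝ ℂ) := by
    apply Matrix.inv_eq_right_inv
    rw [hm, ← Matrix.map_mul, Matrix.mul_nonsing_inv _ hu']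
    simp
  unfold transferFn
  rw [this, Matrix.map_add _ (by simp), Matrix.map_mul, Matrix.map_mul]

lemma core {n nv nw ne nd : ℕ} {A : Matrix (Fin n) (Fin n) ℝ} (hA : SchurStable A)
    (Bw : Matrix (Fin n) (Fin nw) ℝ) (Bd : Matrix (Fin n) (Fin nd) ℝ)
    (Cv : Matrix (Fin nv) (Fin n) ℝ) (Ce : Matrix (Fin ne) (Fin n) ℝ)
    (Dvw : Matrix (Fin nv) (Fin nw) ℝ) (Dvd : Matrix (Fin nv) (Fin nd) ℝ)
    (Dew : Matrix (Fin ne) (Fin nw) ℝ) (Ded : Matrix (Fin ne) (Fin nd) ℝ)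
    (z : ℂ) (hz : ‖z‖ = 1)
    (hno : ∀ (w : Fin nw → ℂ) (d : Fin nd → ℂ), (w, d) ≠ 0 →
      (z.im ≠ 0 ∨ ((∀ i, (w i).im = 0) ∧ ∀ j,
        ((transferFn A Bw Cv Dvw z *ᵥ w + transferFn A Bd Cv Dvd z *ᵥ d) j).im = 0)) →
      nsq w ≤ nsq (transferFn A Bw Cv Dvw z *ᵥ w + transferFn A Bd Cv Dvd z *ᵥ d) →
      nsq (transferFn A Bw Ce Dew z *ᵥ w + transferFn A Bd Ce Ded z *ᵥ d) < nsq d) :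
    ∃ s : ℝ, 0 < s ∧ ∀ (w : Fin nw → ℂ) (d : Fin nd → ℂ), (w, d) ≠ 0 →
      s * (nsq (transferFn A Bw Cv Dvw z *ᵥ w + transferFn A Bd Cv Dvd z *ᵥ d) - nsq w)
       + (nsq (transferFn A Bw Ce Dew z *ᵥ w + transferFn A Bd Ce Ded z *ᵥ d) - nsq d) < 0 := by
  by_cases him : z.im = 0
  · obtain ⟨r, rfl⟩ : ∃ r : ℝ, z = r := ⟨z.re, by apply Complex.ext <;> simp [him]⟩
    have hr : 1 ≤ |r| := by
      rw [Complex.norm_real, Real.norm_eq_abs] at hz; exact hz.ge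
    obtain ⟨Y, hY⟩ := transfer_real hA r hr
    simp only [hY] at hno ⊢
    apply core_real
    intro w d h h1
    have e : ∀ (k : ℕ) (P : Matrix (Fin k) (Fin nw) ℝ) (Q : Matrix (Fin k) (Fin nd) ℝ),
      P.map (algebraMap ℝ ℂ) *ᵥ rc w + Q.map (algebraMap ℝ ℂ) *ᵥ rc d = rc (P *ᵥ w + Q *ᵥ d) := by
      intro k P Q
      rw [rc_mulVec, rc_mulVec, rc_add]
    have := hno (rc w) (rc d) (by
      intro h2
      obtain ⟨h3, h4⟩ := Prod.mk.inj h2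
      apply h
      ext i
      · simpa [rc] using congrFun h3 i
      · simpa [rc] using congrFun h4 i)
    rw [e, e] at this
    exact this (Or.inr ⟨fun i => by simp [rc], fun i => by simp [rc]⟩) h1
  · obtain ⟨s, hs, H⟩ := s_lemma_lin (V := (Fin nw → ℂ) × (Fin nd → ℂ))
      (((transferFn A Bw Cv Dvw z).mulVecLin.coprod (transferFn A Bd Cv Dvd z).mulVecLin).restrictScalars ℝ)
      (LinearMap.fst ℝ _ _)
      (((transferFn A Bw Ce Dew z).mulVecLin.coprod (transferFn A Bd Ce Ded z).mulVecLin).restrictScalars ℝ)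
      (LinearMap.snd ℝ _ _)
      (by rintro ⟨w, d⟩ hx h; exact hno w d hx (Or.inl him) h)
    exact ⟨s, hs, fun w d h => H (w, d) h⟩

lemma scale_mulVec {nv nw ne nd : ℕ} (s : ℝ) (hs : 0 < s)
    (M11 : Matrix (Fin nv) (Fin nw) ℂ) (M12 : Matrix (Fin nv) (Fin nd) ℂ)
    (M21 : Matrix (Fin ne) (Fin nw) ℂ) (M22 : Matrix (Fin ne) (Fin nd) ℂ)
    (w : Fin nw → ℂ) (d : Fin nd → ℂ) :
    (Matrix.fromBlocks ((s : ℂ) • (1 : Matrix (Fin nv) (Fin nv) ℂ)) 0 0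
                (1 : Matrix (Fin ne) (Fin ne) ℂ) *
              Matrix.fromBlocks M11 M12 M21 M22 *
              Matrix.fromBlocks (((s⁻¹ : ℝ) : ℂ) • (1 : Matrix (Fin nw) (Fin nw) ℂ)) 0 0
                (1 : Matrix (Fin nd) (Fin nd) ℂ)) *ᵥ Sum.elim ((s : ℂ) • w) d =
      Sum.elim ((s : ℂ) • (M11 *ᵥ w + M12 *ᵥ d)) (M21 *ᵥ w + M22 *ᵥ d) := by
  have hs0 : (s : ℂ) ≠ 0 := by exact_mod_cast hs.ne'
  rw [← Matrix.mulVec_mulVec, ← Matrix.mulVec_mulVec, Matrix.fromBlocks_mulVec,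
    Matrix.fromBlocks_mulVec, Matrix.fromBlocks_mulVec]
  simp [Matrix.smul_mulVec, smul_smul, inv_mul_cancel₀ hs0, -Complex.coe_smul, -Complex.real_smul]

lemma scale_iff {nv nw ne nd : ℕ} (s : ℝ) (hs : 0 < s)
    (M11 : Matrix (Fin nv) (Fin nw) ℂ) (M12 : Matrix (Fin nv) (Fin nd) ℂ)
    (M21 : Matrix (Fin ne) (Fin nw) ℂ) (M22 : Matrix (Fin ne) (Fin nd) ℂ) :
    sigmaMax (Matrix.fromBlocks ((s : ℂ) • (1 : Matrix (Fin nv) (Fin nv) ℂ)) 0 0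
                (1 : Matrix (Fin ne) (Fin ne) ℂ) *
              Matrix.fromBlocks M11 M12 M21 M22 *
              Matrix.fromBlocks (((s⁻¹ : ℝ) : ℂ) • (1 : Matrix (Fin nw) (Fin nw) ℂ)) 0 0
                (1 : Matrix (Fin nd) (Fin nd) ℂ)) < 1 ↔
    ∀ (w : Fin nw → ℂ) (d : Fin nd → ℂ), (w, d) ≠ 0 →
      s ^ 2 * (nsq (M11 *ᵥ w + M12 *ᵥ d) - nsq w) + (nsq (M21 *ᵥ w + M22 *ᵥ d) - nsq d) < 0 := by
  have hs0 : (s : ℂ) ≠ 0 := by exact_mod_cast hs.ne'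
  have hn : ‖(s : ℂ)‖ ^ 2 = s ^ 2 := by simp
  constructor
  · intro h w d hwd
    have := sigmaMax_lt_one h (x := Sum.elim ((s : ℂ) • w) d) (by
      intro h0
      apply hwd
      have h1 := congrArg (fun g => g ∘ Sum.inl) h0
      have h2 := congrArg (fun g => g ∘ Sum.inr) h0
      simp only [Sum.elim_comp_inl, Sum.elim_comp_inr] at h1 h2
      have h1' : (s : ℂ) • w = 0 := h1
      have h2' : d = 0 := h2
      rw [smul_eq_zero_iff_right hs0] at h1'
      rw [h1', h2']; rfl)
    rw [scale_mulVec s hs, nsq_elim, nsq_elim, nsq_smul, nsq_smul, hn] at this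
    linarith
  · intro h
    apply sigmaMax_lt_one_of
    intro X hX
    obtain ⟨w, d, rfl⟩ : ∃ (w : Fin nw → ℂ) (d : Fin nd → ℂ), X = Sum.elim ((s : ℂ) • w) d := by
      refine ⟨(s : ℂ)⁻¹ • (X ∘ Sum.inl), X ∘ Sum.inr, ?_⟩
      rw [smul_smul, mul_inv_cancel₀ hs0, one_smul]; simp
    rw [scale_mulVec s hs, nsq_elim, nsq_elim, nsq_smul, nsq_smul, hn]
    have := h w d (by
      intro h0
      obtain ⟨rfl, rfl⟩ := Prod.mk.inj h0
      apply hX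
      ext i; rcases i with i | i <;> simp)
    linarith

/-- Robust performance via `D`-scales (Lemma A.4 of the paper):
the frequency-domain D-scale test is equivalent to well-posedness,
robust stability, and robust performance for all stable LTI uncertainties
of `H∞` norm at most one. -/
theorem robust_performance_D_scales
    (n nv ne nw nd : ℕ)
    (A : Matrix (Fin n) (Fin n) ℝ) (hA : SchurStable A)
    (Bw : Matrix (Fin n) (Fin nw) ℝ) (Bd : Matrix (Fin n) (Fin nd) ℝ)
    (Cv : Matrix (Fin nv) (Fin n) ℝ) (Ce : Matrix (Fin ne) (Fin n) ℝ)
    (Dvw : Matrix (Fin nv) (Fin nw) ℝ) (Dvd : Matrix (Fin nv) (Fin nd) ℝ)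
    (Dew : Matrix (Fin ne) (Fin nw) ℝ) (Ded : Matrix (Fin ne) (Fin nd) ℝ) :
    ((∃ Ds : ℝ → ℝ,
        (∀ θ ∈ Set.Icc (0 : ℝ) (2 * Real.pi), 0 < Ds θ) ∧
        (∀ θ ∈ Set.Icc (0 : ℝ) (2 * Real.pi),
          sigmaMax
            (Matrix.fromBlocks ((Ds θ : ℂ) • (1 : Matrix (Fin nv) (Fin nv) ℂ)) 0 0
                (1 : Matrix (Fin ne) (Fin ne) ℂ) *
              Matrix.fromBlocks
                (transferFn A Bw Cv Dvw (Complex.exp ((θ : ℂ) * Complex.I)))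
                (transferFn A Bd Cv Dvd (Complex.exp ((θ : ℂ) * Complex.I)))
                (transferFn A Bw Ce Dew (Complex.exp ((θ : ℂ) * Complex.I)))
                (transferFn A Bd Ce Ded (Complex.exp ((θ : ℂ) * Complex.I))) *
              Matrix.fromBlocks ((((Ds θ)⁻¹ : ℝ) : ℂ) • (1 : Matrix (Fin nw) (Fin nw) ℂ)) 0 0
                (1 : Matrix (Fin nd) (Fin nd) ℂ)) < 1)) ↔
      (∀ (m : ℕ) (AΔ : Matrix (Fin m) (Fin m) ℝ) (BΔ : Matrix (Fin m) (Fin nv) ℝ)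
          (CΔ : Matrix (Fin nw) (Fin m) ℝ) (DΔ : Matrix (Fin nw) (Fin nv) ℝ),
        SchurStable AΔ →
        (∀ θ ∈ Set.Icc (0 : ℝ) (2 * Real.pi),
          sigmaMax (transferFn AΔ BΔ CΔ DΔ (Complex.exp ((θ : ℂ) * Complex.I))) ≤ 1) →
        IsUnit ((1 : Matrix (Fin nv) (Fin nv) ℝ) - Dvw * DΔ) ∧
        SchurStable (interconnectA A Bw Cv Dvw AΔ BΔ CΔ DΔ) ∧
        (∀ θ ∈ Set.Icc (0 : ℝ) (2 * Real.pi),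
          sigmaMax
            (transferFn A Bd Ce Ded (Complex.exp ((θ : ℂ) * Complex.I)) +
              transferFn A Bw Ce Dew (Complex.exp ((θ : ℂ) * Complex.I)) *
                transferFn AΔ BΔ CΔ DΔ (Complex.exp ((θ : ℂ) * Complex.I)) *
                ((1 : Matrix (Fin nv) (Fin nv) ℂ) -
                  transferFn A Bw Cv Dvw (Complex.exp ((θ : ℂ) * Complex.I)) *
                    transferFn AΔ BΔ CΔ DΔ (Complex.exp ((θ : ℂ) * Complex.I)))⁻¹ *
                transferFn A Bd Cv Dvd (Complex.exp ((θ : ℂ) * Complex.I))) < 1))) := by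
  constructor
  · rintro ⟨Ds, hpos, hD⟩ m AΔ BΔ CΔ DΔ hAΔ hΔ
    have hD' := fun θ hθ => (scale_iff (Ds θ) (hpos θ hθ) _ _ _ _).1 (hD θ hθ)
    -- the first block is a strict contraction
    have hM : ∀ θ ∈ Set.Icc (0 : ℝ) (2 * Real.pi),
        sigmaMax (transferFn A Bw Cv Dvw (Complex.exp ((θ : ℂ) * Complex.I))) < 1 := by
      intro θ hθ
      apply sigmaMax_lt_one_of
      intro w hw
      have h1 := hD' θ hθ w 0 (fun h => hw (Prod.mk.inj h).1)
      rw [Matrix.mulVec_zero, Matrix.mulVec_zero, add_zero, add_zero, nsq_zero] at h1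
      have h2 := nsq_nonneg (transferFn A Bw Ce Dew (Complex.exp ((θ : ℂ) * Complex.I)) *ᵥ w)
      have h3 : 0 < Ds θ ^ 2 := pow_pos (hpos θ hθ) 2
      by_contra hcon
      nlinarith [mul_nonneg h3.le (sub_nonneg.2 (not_lt.1 hcon))]
    obtain ⟨θ1, hθ1, hM1, hM0⟩ := max_mod A Bw Cv Dvw hA
    obtain ⟨θ2, hθ2, hΔ1, hΔ0⟩ := max_mod AΔ BΔ CΔ DΔ hAΔ
    have inj : ∀ (P : Matrix (Fin nv) (Fin nw) ℂ) (Q : Matrix (Fin nw) (Fin nv) ℂ),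
        sigmaMax P < 1 → sigmaMax Q ≤ 1 → ∀ v, v = P *ᵥ (Q *ᵥ v) → v = 0 := by
      intro P Q hP hQ v hv
      by_contra hv0
      have h1 := (sigmaMax_le_one_iff Q).1 hQ v
      have h2 : Q *ᵥ v ≠ 0 := by
        intro h; rw [h, Matrix.mulVec_zero] at hv; exact hv0 hv
      have h3 := sigmaMax_lt_one hP h2
      rw [← hv] at h3
      linarith
    have hinj : ∀ z : ℂ, 1 ≤ ‖z‖ → ∀ v : Fin nv → ℂ,
        v = transferFn A Bw Cv Dvw z *ᵥ (transferFn AΔ BΔ CΔ DΔ z *ᵥ v) → v = 0 :=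
      fun z hz => inj _ _ ((hM1 z hz).trans_lt (hM θ1 hθ1)) ((hΔ1 z hz).trans (hΔ θ2 hθ2))
    have hwp : IsUnit ((1 : Matrix (Fin nv) (Fin nv) ℝ) - Dvw * DΔ) := by
      rw [← isUnit_mapC_iff]
      apply isUnit_of_inj
      intro v hv
      apply inj _ _ (hM0.trans_lt (hM θ1 hθ1)) (hΔ0.trans (hΔ θ2 hθ2)) v
      rw [Matrix.map_sub _ (by simp), Matrix.map_mul, Matrix.sub_mulVec, ← Matrix.mulVec_mulVec,
        sub_eq_zero] at hv
      simpa using hv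
    refine ⟨hwp, loop_stable A Bw Cv Dvw AΔ BΔ CΔ DΔ hA hAΔ hwp hinj, ?_⟩
    intro θ hθ
    have hz : ‖Complex.exp ((θ : ℂ) * Complex.I)‖ = 1 := Complex.norm_exp_ofReal_mul_I θ
    have h1 := hD' θ hθ
    have h2 := (sigmaMax_le_one_iff _).1 (hΔ θ hθ)
    have h3 := hinj _ hz.ge
    have hs : 0 < Ds θ ^ 2 := pow_pos (hpos θ hθ) 2
    generalize transferFn AΔ BΔ CΔ DΔ (Complex.exp ((θ : ℂ) * Complex.I)) = Q at *
    generalize transferFn A Bw Cv Dvw (Complex.exp ((θ : ℂ) * Complex.I)) = M11 at *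
    generalize transferFn A Bd Cv Dvd (Complex.exp ((θ : ℂ) * Complex.I)) = M12 at *
    generalize transferFn A Bw Ce Dew (Complex.exp ((θ : ℂ) * Complex.I)) = M21 at *
    generalize transferFn A Bd Ce Ded (Complex.exp ((θ : ℂ) * Complex.I)) = M22 at *
    have hu : IsUnit ((1 : Matrix (Fin nv) (Fin nv) ℂ) - M11 * Q) := by
      apply isUnit_of_inj
      intro v hv
      apply h3
      rwa [Matrix.sub_mulVec, Matrix.one_mulVec, ← Matrix.mulVec_mulVec, sub_eq_zero] at hv
    apply sigmaMax_lt_one_of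
    intro d hd
    rw [Matrix.add_mulVec, ← Matrix.mulVec_mulVec, ← Matrix.mulVec_mulVec, ← Matrix.mulVec_mulVec]
    set v := (1 - M11 * Q)⁻¹ *ᵥ (M12 *ᵥ d) with hv
    have hv' : v = M11 *ᵥ (Q *ᵥ v) + M12 *ᵥ d := by
      have : (1 - M11 * Q) *ᵥ v = M12 *ᵥ d := by
        rw [hv, Matrix.mulVec_mulVec,
          Matrix.mul_nonsing_inv _ ((Matrix.isUnit_iff_isUnit_det _).1 hu), Matrix.one_mulVec]
      rw [Matrix.sub_mulVec, Matrix.one_mulVec, ← Matrix.mulVec_mulVec] at this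
      rw [← this]; simp
    have h4 := h1 (Q *ᵥ v) d (fun h => hd (Prod.mk.inj h).2)
    rw [← hv'] at h4
    have h5 := mul_nonneg hs.le (sub_nonneg.2 (h2 v))
    rw [add_comm]
    linarith
  · intro hB
    have key : ∀ θ : ℝ, ∃ s : ℝ, 0 < s ∧ ∀ (w : Fin nw → ℂ) (d : Fin nd → ℂ), (w, d) ≠ 0 →
        s * (nsq (transferFn A Bw Cv Dvw (Complex.exp ((θ : ℂ) * Complex.I)) *ᵥ w +
          transferFn A Bd Cv Dvd (Complex.exp ((θ : ℂ) * Complex.I)) *ᵥ d) - nsq w)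
        + (nsq (transferFn A Bw Ce Dew (Complex.exp ((θ : ℂ) * Complex.I)) *ᵥ w +
          transferFn A Bd Ce Ded (Complex.exp ((θ : ℂ) * Complex.I)) *ᵥ d) - nsq d) < 0 ∨
        θ ∉ Set.Icc (0 : ℝ) (2 * Real.pi) := by
      intro θ
      by_cases hθ : θ ∈ Set.Icc (0 : ℝ) (2 * Real.pi)
      swap
      · exact ⟨1, one_pos, fun _ _ _ => Or.inr hθ⟩
      have hz : ‖Complex.exp ((θ : ℂ) * Complex.I)‖ = 1 := Complex.norm_exp_ofReal_mul_I θ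
      obtain ⟨s, hs, H⟩ := core hA Bw Bd Cv Ce Dvw Dvd Dew Ded _ hz (by
        intro w d hwd hreal hle
        obtain ⟨m, AΔ, BΔ, CΔ, DΔ, hAΔ, hn, hi⟩ := interp _ hz w _ hle hreal
        obtain ⟨hwp, hst, hperf⟩ := hB m AΔ BΔ CΔ DΔ hAΔ
          (fun θ' _ => hn _ (Complex.norm_exp_ofReal_mul_I θ'))
        have h3 := loop_inj A Bw Cv Dvw AΔ BΔ CΔ DΔ hA hAΔ hwp hst _ hz.ge
        have h4 := hperf θ hθ
        clear hperf hn hreal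
        generalize transferFn AΔ BΔ CΔ DΔ (Complex.exp ((θ : ℂ) * Complex.I)) = Q at *
        generalize transferFn A Bw Cv Dvw (Complex.exp ((θ : ℂ) * Complex.I)) = M11 at *
        generalize transferFn A Bd Cv Dvd (Complex.exp ((θ : ℂ) * Complex.I)) = M12 at *
        generalize transferFn A Bw Ce Dew (Complex.exp ((θ : ℂ) * Complex.I)) = M21 at *
        generalize transferFn A Bd Ce Ded (Complex.exp ((θ : ℂ) * Complex.I)) = M22 at *
        have hu : IsUnit ((1 : Matrix (Fin nv) (Fin nv) ℂ) - M11 * Q) := by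
          apply isUnit_of_inj
          intro v hv
          apply h3
          rwa [Matrix.sub_mulVec, Matrix.one_mulVec, ← Matrix.mulVec_mulVec, sub_eq_zero] at hv
        obtain ⟨v, hv⟩ : ∃ v, v = M11 *ᵥ w + M12 *ᵥ d := ⟨_, rfl⟩
        rw [← hv] at hi hle
        have hd : d ≠ 0 := by
          rintro rfl
          rw [Matrix.mulVec_zero, add_zero] at hv
          have hv0 : v = 0 := h3 v (by rw [hi]; exact hv)
          rw [hv0, Matrix.mulVec_zero] at hi
          exact hwd (by rw [← hi]; rfl)
        have h5 := sigmaMax_lt_one h4 hd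
        have hv2 : (1 - M11 * Q)⁻¹ *ᵥ (M12 *ᵥ d) = v := by
          have : (1 - M11 * Q) *ᵥ v = M12 *ᵥ d := by
            rw [Matrix.sub_mulVec, Matrix.one_mulVec, ← Matrix.mulVec_mulVec, hi, hv]; simp
          rw [← this, Matrix.mulVec_mulVec,
            Matrix.nonsing_inv_mul _ ((Matrix.isUnit_iff_isUnit_det _).1 hu), Matrix.one_mulVec]
        rw [Matrix.add_mulVec, ← Matrix.mulVec_mulVec, ← Matrix.mulVec_mulVec,
          ← Matrix.mulVec_mulVec, hv2, hi, add_comm] at h5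
        exact h5)
      exact ⟨s, hs, fun w d h => Or.inl (H w d h)⟩
    choose s hs H using key
    refine ⟨fun θ => Real.sqrt (s θ), fun θ _ => Real.sqrt_pos.2 (hs θ), fun θ hθ => ?_⟩
    rw [scale_iff _ (Real.sqrt_pos.2 (hs θ)), Real.sq_sqrt (hs θ).le]
    intro w d h
    exact (H θ w d h).resolve_right (fun h => h hθ)
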